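/- Let Ω ⊆ ℂⁿ be a bounded domain admitting a spherically-extreme boundary point p (∂Ω is C² near p via a local defining function, and some ball containing Ω has p on its boundary). Then the unit ball is exhausted by biholomorphic images of Ω: there exists a sequence of injective holomorphic maps f_j : Ω → 𝔹ⁿ such that for every compact set K ⊆ 𝔹ⁿ there is an index j₀ with K ⊆ f_j(Ω) for all j ≥ j₀. -/

import Mathlib

open Metric Set

/-- A holomorphic function on the right half-plane equal to `1` at the origin, small far from it,
and decaying so slowly that its oscillation on a logarithmic scale is at most `a`. -/
lemma exists_slow_cutoff (a d t : ℝ) (ha : 0 < a) (hd : 0 < d) (ht : 0 < t) :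
    ∃ (g : ℂ → ℂ) (L : ℝ), 0 < L ∧ DifferentiableOn ℂ g {u | 0 < u.re} ∧
      (∀ u : ℂ, 0 ≤ u.re → ‖g u‖ ≤ 1) ∧
      (∀ u : ℂ, 0 ≤ u.re → ‖g u - ((‖g u‖ : ℝ) : ℂ)‖ ≤ a) ∧
      (∀ m : ℝ, 0 < m → ∀ u v : ℂ, m ≤ u.re → m ≤ v.re → ‖g u - g v‖ ≤ a / m * ‖u - v‖) ∧
      (∀ u : ℂ, d ≤ u.re → ‖g u‖ ≤ t) ∧
      (∀ u : ℂ, 0 ≤ u.re → ‖g u - 1‖ ≤ L * ‖u‖) := by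
  set α : ℝ := a / 2 with hα
  have hα0 : 0 < α := by positivity
  obtain ⟨N, hN0, hN⟩ : ∃ N : ℝ, 0 < N ∧ (N * d) ^ (-α) ≤ t := by
    have h1 : Filter.Tendsto (fun N : ℝ => (N * d) ^ (-α)) Filter.atTop (nhds 0) :=
      (tendsto_rpow_neg_atTop hα0).comp (Filter.tendsto_id.atTop_mul_const hd)
    obtain ⟨N, h, h'⟩ := ((h1.eventually (ge_mem_nhds ht)).and
      (Filter.eventually_gt_atTop 0)).exists
    exact ⟨N, h', h⟩
  have hre : ∀ u : ℂ, (1 + (N : ℂ) * u).re = 1 + N * u.re := fun u => by simp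
  have hslit : ∀ u : ℂ, 0 ≤ u.re → 1 + (N : ℂ) * u ∈ Complex.slitPlane := fun u hu =>
    Or.inl (by rw [hre]; positivity)
  have hge : ∀ u : ℂ, 1 + N * u.re ≤ ‖1 + (N : ℂ) * u‖ := fun u => by
    rw [← hre]; exact Complex.re_le_norm _
  set g : ℂ → ℂ := fun u => (1 + (N : ℂ) * u) ^ ((-α : ℝ) : ℂ) with hg
  have hnorm : ∀ u, ‖g u‖ = ‖1 + (N : ℂ) * u‖ ^ (-α) := fun u => Complex.norm_cpow_real _ _
  have hderiv : ∀ u : ℂ, 0 ≤ u.re → HasDerivAt g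
      (((-α : ℝ) : ℂ) * (1 + (N : ℂ) * u) ^ (((-α : ℝ) : ℂ) - 1) * N) u := fun u hu => by
    have h : HasDerivAt (fun u : ℂ => 1 + (N : ℂ) * u) N u := by
      simpa using ((hasDerivAt_id u).const_mul (N : ℂ)).const_add 1
    exact h.cpow_const (hslit u hu)
  have hdnorm : ∀ m : ℝ, 0 ≤ m → ∀ u : ℂ, m ≤ u.re →
      ‖((-α : ℝ) : ℂ) * (1 + (N : ℂ) * u) ^ (((-α : ℝ) : ℂ) - 1) * N‖ ≤ α * N / (1 + N * m) := by
    intro m hm u hu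
    have h1 : 1 + N * m ≤ ‖1 + (N : ℂ) * u‖ := le_trans (by gcongr) (hge u)
    have h0 : 0 < 1 + N * m := by positivity
    have h2 : ‖(1 + (N : ℂ) * u) ^ (((-α : ℝ) : ℂ) - 1)‖ ≤ (1 + N * m)⁻¹ := by
      have : (((-α : ℝ) : ℂ) - 1) = ((-α - 1 : ℝ) : ℂ) := by push_cast; ring
      rw [this, Complex.norm_cpow_real]
      calc ‖1 + (N : ℂ) * u‖ ^ (-α - 1) ≤ (1 + N * m) ^ (-α - 1) :=
            Real.rpow_le_rpow_of_nonpos h0 h1 (by linarith)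
        _ ≤ (1 + N * m) ^ (-1 : ℝ) := by
            apply Real.rpow_le_rpow_of_exponent_le _ (by linarith)
            have : 0 ≤ N * m := by positivity
            linarith
        _ = _ := Real.rpow_neg_one _
    rw [norm_mul, norm_mul, Complex.norm_real, Complex.norm_real, Real.norm_eq_abs,
      Real.norm_eq_abs, abs_neg, abs_of_pos hα0, abs_of_pos hN0, div_eq_mul_inv]
    calc α * _ * N ≤ α * (1 + N * m)⁻¹ * N := by gcongr
      _ = _ := by ring
  have hlip : ∀ m : ℝ, 0 ≤ m → ∀ u v : ℂ, m ≤ u.re → m ≤ v.re →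
      ‖g u - g v‖ ≤ α * N / (1 + N * m) * ‖u - v‖ := fun m hm u v hu hv =>
    Convex.norm_image_sub_le_of_norm_hasDerivWithin_le (s := {c : ℂ | m ≤ c.re})
      (fun x hx => (hderiv x (hm.trans hx)).hasDerivWithinAt) (fun x hx => hdnorm m hm x hx)
      (convex_halfSpace_re_ge m) hv hu
  refine ⟨g, α * N, by positivity, ?_, ?_, ?_, ?_, ?_, ?_⟩
  · exact fun u hu => (hderiv u (le_of_lt hu)).differentiableAt.differentiableWithinAt
  · intro u hu
    rw [hnorm]
    apply Real.rpow_le_one_of_one_le_of_nonpos _ (by linarith)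
    have := hge u
    have : 0 ≤ N * u.re := by positivity
    linarith
  · intro u hu
    have hne : 1 + (N : ℂ) * u ≠ 0 := Complex.slitPlane_ne_zero (hslit u hu)
    have harg : |(1 + (N : ℂ) * u).arg| ≤ Real.pi / 2 :=
      Complex.abs_arg_le_pi_div_two_iff.2 (by rw [hre]; positivity)
    have hpos : 0 < ‖1 + (N : ℂ) * u‖ := norm_pos_iff.2 hne
    have hle1 : ‖g u‖ ≤ 1 := by
      rw [hnorm]
      apply Real.rpow_le_one_of_one_le_of_nonpos _ (by linarith)
      have := hge u
      have : 0 ≤ N * u.re := by positivity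
      linarith
    have heq : g u = (‖g u‖ : ℝ) *
        Complex.exp (Complex.I * ((-α * (1 + (N : ℂ) * u).arg : ℝ) : ℂ)) := by
      rw [hnorm, Real.rpow_def_of_pos hpos, hg]
      simp only
      rw [Complex.cpow_def_of_ne_zero hne, Complex.log]
      push_cast
      rw [← Complex.exp_add]
      congr 1
      ring
    have h3 : g u - ((‖g u‖ : ℝ) : ℂ) = (‖g u‖ : ℝ) *
        (Complex.exp (Complex.I * ((-α * (1 + (N : ℂ) * u).arg : ℝ) : ℂ)) - 1) := by
      rw [mul_sub, ← heq, mul_one]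
    rw [h3, norm_mul, Complex.norm_real, norm_norm]
    have h4 := Real.norm_exp_I_mul_ofReal_sub_one_le (x := -α * (1 + (N : ℂ) * u).arg)
    rw [Real.norm_eq_abs, abs_mul, abs_neg, abs_of_pos hα0] at h4
    have h5 : α * |(1 + (N : ℂ) * u).arg| ≤ a := by
      have := Real.pi_lt_four
      rw [hα]; nlinarith
    calc _ ≤ 1 * a := mul_le_mul hle1 (h4.trans h5) (norm_nonneg _) zero_le_one
      _ = a := one_mul a
  · intro m hm u v hu hv
    refine (hlip m hm.le u v hu hv).trans ?_
    refine mul_le_mul_of_nonneg_right ?_ (norm_nonneg _)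
    rw [div_le_div_iff₀ (by positivity) hm]
    have h1 : 0 < α * N * m := by positivity
    have h2 : a = 2 * α := by rw [hα]; ring
    rw [h2]
    nlinarith
  · intro u hu
    rw [hnorm]
    refine le_trans ?_ hN
    apply Real.rpow_le_rpow_of_nonpos (by positivity) _ (by linarith)
    refine le_trans ?_ (hge u)
    have : N * d ≤ N * u.re := by gcongr
    linarith
  · intro u hu
    have h := hlip 0 le_rfl u 0 hu (by simp)
    have h0 : g 0 = 1 := by simp [hg]
    rw [h0] at h
    simpa using h

set_option maxHeartbeats 1600000 in
/-- Normalization of the second order terms: if `U` is tangent at the origin to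
`{‖z‖² + Re Λ(z, z) < Re w}` to second order and lies in a ball, a globally injective shear removes
the pluriharmonic term `Re Λ(z, z)`, and pinches `U` between two hyperquadrics. -/
lemma exists_shear {F : Type*} [NormedAddCommGroup F] [NormedSpace ℂ F]
    (Λ : F →L[ℂ] F →L[ℂ] ℂ) (U : Set (ℂ × F)) (κ : ℝ) (hκ : 0 < κ) (hκ1 : κ ≤ 1)
    (hq : ∀ z, κ * ‖z‖ ^ 2 ≤ ‖z‖ ^ 2 + (Λ z z).re)
    (hU : ∀ w z, (w, z) ∈ U → κ * (‖z‖ ^ 2 + ‖w‖ ^ 2) < w.re)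
    (hT : ∀ η : ℝ, 0 < η → ∃ C > 0, ∃ δ > 0, ∀ (w : ℂ) (z : F), ‖w‖ < δ → ‖z‖ < δ →
      ((w, z) ∈ U → ‖z‖ ^ 2 + (Λ z z).re - η * ‖z‖ ^ 2 - C * ‖w‖ ^ 2 ≤ w.re) ∧
      (‖z‖ ^ 2 + (Λ z z).re + η * ‖z‖ ^ 2 + C * ‖w‖ ^ 2 < w.re → (w, z) ∈ U))
    (ε : ℝ) (hε : 0 < ε) :
    ∃ (g : ℂ → ℂ) (C : ℝ), 0 < C ∧ DifferentiableOn ℂ g {u | 0 < u.re} ∧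
      (∀ w w' z, (w, z) ∈ U → (w', z) ∈ U →
        w - Λ z z * g w = w' - Λ z z * g w' → w = w') ∧
      (∀ w z, (w, z) ∈ U → (1 - ε) * ‖z‖ ^ 2 <
        (w - Λ z z * g w).re + C * ‖w - Λ z z * g w‖ ^ 2) ∧
      (∀ w' z, (1 + ε) * ‖z‖ ^ 2 + C * ‖w'‖ ^ 2 < w'.re →
        ∃ w, (w, z) ∈ U ∧ w - Λ z z * g w = w') := by
  obtain ⟨M, hM0, hM⟩ : ∃ M : ℝ, 0 < M ∧ ∀ z, ‖Λ z z‖ ≤ M * ‖z‖ ^ 2 := by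
    refine ⟨‖Λ‖ + 1, by positivity, fun z => ?_⟩
    calc ‖Λ z z‖ ≤ ‖Λ‖ * ‖z‖ * ‖z‖ := Λ.le_opNorm₂ z z
      _ ≤ (‖Λ‖ + 1) * ‖z‖ ^ 2 := by nlinarith [sq_nonneg ‖z‖]
  set η : ℝ := min (κ / 4) (ε / 2) with hη
  have hη0 : 0 < η := by positivity
  have hηκ : η ≤ κ / 4 := min_le_left _ _
  have hηε : η ≤ ε / 2 := min_le_right _ _
  obtain ⟨C₁, hC₁, δ, hδ, hT⟩ := hT η hη0
  set K : ℝ := 2 * (1 + 2 * M / κ) with hK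
  have hK0 : 0 < K := by positivity
  -- the radius in `w` on which the Taylor expansion is used
  obtain ⟨δ₁, hδ₁, hδ₁δ, hδ₁κ, hδ₁C⟩ : ∃ δ₁ : ℝ, 0 < δ₁ ∧ δ₁ ≤ δ ∧ δ₁ ≤ κ * δ ^ 2 ∧
      2 * M / κ * C₁ * δ₁ ≤ 1 / 2 := by
    refine ⟨min (min δ (κ * δ ^ 2)) (1 / 2 / (2 * M / κ * C₁)), by positivity,
      (min_le_left _ _).trans (min_le_left _ _), (min_le_left _ _).trans (min_le_right _ _), ?_⟩
    rw [mul_comm, ← le_div_iff₀ (by positivity)]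
    exact min_le_right _ _
  set a : ℝ := min (κ / (4 * M)) (ε / (2 * M)) with ha
  have ha0 : 0 < a := by positivity
  have haκ : a * M ≤ κ / 4 := by
    have : a ≤ κ / (4 * M) := min_le_left _ _
    calc a * M ≤ κ / (4 * M) * M := by gcongr
      _ = κ / 4 := by field_simp
  have haε : a * M ≤ ε / 2 := by
    have : a ≤ ε / (2 * M) := min_le_right _ _
    calc a * M ≤ ε / (2 * M) * M := by gcongr
      _ = ε / 2 := by field_simp
  obtain ⟨g, L, hL, hgd, hg1, hga, hgl, hgt, hgL⟩ :=
    exists_slow_cutoff a (κ * δ₁ ^ 2) (κ / (2 * M)) ha0 (by positivity) (by positivity)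
  set δ₂ : ℝ := min δ₁ (ε / (2 * M) / L) with hδ₂
  have hδ₂0 : 0 < δ₂ := by positivity
  have hδ₂1 : δ₂ ≤ δ₁ := min_le_left _ _
  have hδ₂L : L * δ₂ * M ≤ ε / 2 := by
    have : δ₂ ≤ ε / (2 * M) / L := min_le_right _ _
    calc L * δ₂ * M ≤ L * (ε / (2 * M) / L) * M := by gcongr
      _ = ε / 2 := by field_simp
  -- comparison of `Λ z z * g w` with `‖g w‖ * Λ z z`
  have hPg : ∀ (w : ℂ) (z : F), 0 ≤ w.re →
      |(Λ z z * g w).re - ‖g w‖ * (Λ z z).re| ≤ a * M * ‖z‖ ^ 2 := by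
    intro w z hw
    have h1 : (Λ z z * g w).re - ‖g w‖ * (Λ z z).re =
        (Λ z z * (g w - ((‖g w‖ : ℝ) : ℂ))).re := by
      rw [mul_sub, Complex.sub_re, mul_comm (Λ z z) ((‖g w‖ : ℝ) : ℂ), Complex.re_ofReal_mul]
    rw [h1]
    refine (Complex.abs_re_le_norm _).trans ?_
    rw [norm_mul]
    calc _ ≤ M * ‖z‖ ^ 2 * a := mul_le_mul (hM z) (hga w hw) (norm_nonneg _) (by positivity)
      _ = _ := by ring
  have hPg1 : ∀ (w : ℂ) (z : F), 0 ≤ w.re → ‖w‖ < δ₂ →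
      |(Λ z z * g w).re - (Λ z z).re| ≤ ε / 2 * ‖z‖ ^ 2 := by
    intro w z hw hwδ
    have h1 : (Λ z z * g w).re - (Λ z z).re = (Λ z z * (g w - 1)).re := by
      rw [mul_sub, Complex.sub_re, mul_one]
    rw [h1]
    refine (Complex.abs_re_le_norm _).trans ?_
    rw [norm_mul]
    calc _ ≤ M * ‖z‖ ^ 2 * (L * δ₂) := by
          refine mul_le_mul (hM z) ((hgL w hw).trans ?_) (norm_nonneg _) (by positivity)
          gcongr
      _ = L * δ₂ * M * ‖z‖ ^ 2 := by ring
      _ ≤ _ := by gcongr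
  have hPn : ∀ (w : ℂ) (z : F), 0 ≤ w.re → ‖Λ z z * g w‖ ≤ M * ‖z‖ ^ 2 := by
    intro w z hw
    rw [norm_mul]
    calc _ ≤ M * ‖z‖ ^ 2 * 1 := mul_le_mul (hM z) (hg1 w hw) (norm_nonneg _) (by positivity)
      _ = _ := mul_one _
  have hmix : ∀ (s : ℝ) (z : F), 0 ≤ s → s ≤ 1 →
      κ * ‖z‖ ^ 2 ≤ ‖z‖ ^ 2 + s * (Λ z z).re := by
    intro s z h0 h1
    have h2 := mul_le_mul_of_nonneg_left (hq z) h0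
    have h3 : (1 - s) * (κ * ‖z‖ ^ 2) ≤ (1 - s) * ‖z‖ ^ 2 :=
      mul_le_mul_of_nonneg_left (by nlinarith [sq_nonneg ‖z‖]) (by linarith)
    nlinarith
  have hlip : ∀ (w w' : ℂ) (z : F), κ * ‖z‖ ^ 2 ≤ w.re → κ * ‖z‖ ^ 2 ≤ w'.re →
      ‖Λ z z * g w - Λ z z * g w'‖ ≤ 1 / 2 * ‖w - w'‖ := by
    intro w w' z hw hw'
    rcases eq_or_ne z 0 with rfl | hz
    · simp
    have hz0 : 0 < ‖z‖ := norm_pos_iff.2 hz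
    rw [← mul_sub, norm_mul]
    calc _ ≤ M * ‖z‖ ^ 2 * (a / (κ * ‖z‖ ^ 2) * ‖w - w'‖) :=
          mul_le_mul (hM z) (hgl _ (by positivity) w w' hw hw') (norm_nonneg _) (by positivity)
      _ = a * M / κ * ‖w - w'‖ := by field_simp
      _ ≤ _ := by
          refine mul_le_mul_of_nonneg_right ?_ (norm_nonneg _)
          rw [div_le_iff₀ hκ]
          linarith
  have hbd : ∀ w z, (w, z) ∈ U → 0 < w.re ∧ 0 < ‖w‖ ∧ κ * ‖w‖ < 1 ∧ κ * ‖z‖ ^ 2 < ‖w‖ ∧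
      κ ^ 2 * ‖z‖ ^ 2 < 1 := by
    intro w z h
    have h1 := hU w z h
    have hre : 0 < w.re := lt_of_le_of_lt (by positivity) h1
    have h2 : w.re ≤ ‖w‖ := Complex.re_le_norm w
    have h3 : 0 < ‖w‖ := hre.trans_le h2
    have h4 : 0 ≤ κ * ‖z‖ ^ 2 := by positivity
    have h5 : 0 ≤ κ * ‖w‖ ^ 2 := by positivity
    have h6 : κ * ‖w‖ < 1 := by
      by_contra! hcon
      have := mul_le_mul_of_nonneg_right hcon h3.le
      nlinarith
    have h7 : κ * ‖z‖ ^ 2 < ‖w‖ := by nlinarith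
    refine ⟨hre, h3, h6, h7, ?_⟩
    have := mul_lt_mul_of_pos_left h7 hκ
    nlinarith
  have hloc : ∀ w z, (w, z) ∈ U → ‖w‖ < δ₁ →
      ‖z‖ ^ 2 + (Λ z z).re - η * ‖z‖ ^ 2 - C₁ * ‖w‖ ^ 2 ≤ w.re ∧
      κ / 2 * ‖z‖ ^ 2 - C₁ * ‖w‖ ^ 2 ≤ (w - Λ z z * g w).re ∧
      ‖w‖ ≤ K * ‖w - Λ z z * g w‖ := by
    intro w z h hw
    obtain ⟨hre, hw0, -, hzw, -⟩ := hbd w z h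
    have hzδ : ‖z‖ < δ := by
      refine lt_of_pow_lt_pow_left₀ 2 hδ.le ?_
      have : κ * ‖z‖ ^ 2 < κ * δ ^ 2 := by linarith
      exact lt_of_mul_lt_mul_left this hκ.le
    have h1 := (hT w z (hw.trans_le hδ₁δ) hzδ).1 h
    have h2 := (abs_le.1 (hPg w z hre.le)).2
    have h3 := hmix (1 - ‖g w‖) z (by linarith [hg1 w hre.le]) (by linarith [norm_nonneg (g w)])
    have h4 : η * ‖z‖ ^ 2 ≤ κ / 4 * ‖z‖ ^ 2 := by gcongr
    have h5 : a * M * ‖z‖ ^ 2 ≤ κ / 4 * ‖z‖ ^ 2 := by gcongr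
    have h6 : κ / 2 * ‖z‖ ^ 2 - C₁ * ‖w‖ ^ 2 ≤ (w - Λ z z * g w).re := by
      rw [Complex.sub_re]; nlinarith
    refine ⟨h1, h6, ?_⟩
    have h7 : ‖w‖ ≤ ‖w - Λ z z * g w‖ + M * ‖z‖ ^ 2 := by
      calc ‖w‖ = ‖(w - Λ z z * g w) + Λ z z * g w‖ := by rw [sub_add_cancel]
        _ ≤ _ := (norm_add_le _ _).trans (by gcongr; exact hPn w z hre.le)
    set n' := ‖w - Λ z z * g w‖
    have h8 : κ / 2 * ‖z‖ ^ 2 ≤ n' + C₁ * ‖w‖ ^ 2 := by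
      linarith [Complex.re_le_norm (w - Λ z z * g w)]
    have h9 : M * ‖z‖ ^ 2 ≤ 2 * M / κ * (n' + C₁ * ‖w‖ ^ 2) := by
      calc M * ‖z‖ ^ 2 = 2 * M / κ * (κ / 2 * ‖z‖ ^ 2) := by field_simp
        _ ≤ _ := by gcongr
    have h10 : 2 * M / κ * (C₁ * ‖w‖ ^ 2) ≤ 1 / 2 * ‖w‖ := by
      calc 2 * M / κ * (C₁ * ‖w‖ ^ 2) = 2 * M / κ * C₁ * ‖w‖ * ‖w‖ := by ring
        _ ≤ 2 * M / κ * C₁ * δ₁ * ‖w‖ := by gcongr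
        _ ≤ _ := by gcongr
    rw [hK]
    linarith
  have hfar : ∀ w z, (w, z) ∈ U → δ₁ ≤ ‖w‖ → κ * δ₁ ^ 2 / 2 ≤ (w - Λ z z * g w).re := by
    intro w z h hw
    have h1 := hU w z h
    have hre := (hbd w z h).1
    have h2 : κ * δ₁ ^ 2 ≤ κ * ‖w‖ ^ 2 := by gcongr
    have h3 : 0 ≤ κ * ‖z‖ ^ 2 := by positivity
    have h4 : ‖Λ z z * g w‖ ≤ κ / 2 * ‖z‖ ^ 2 := by
      rw [norm_mul]
      calc _ ≤ M * ‖z‖ ^ 2 * (κ / (2 * M)) :=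
            mul_le_mul (hM z) (hgt w (by linarith)) (norm_nonneg _) (by positivity)
        _ = _ := by field_simp
    rw [Complex.sub_re]
    linarith [Complex.re_le_norm (Λ z z * g w)]
  obtain ⟨C, hC0, hCK, hCδ₂, hCδ₁, hC₁M, hCM, hCδ⟩ : ∃ C : ℝ, 0 < C ∧ C₁ * K ^ 2 + 1 ≤ C ∧
      K ^ 2 / (κ ^ 2 * δ₂ ^ 2) ≤ C - C₁ * K ^ 2 ∧ 1 / (κ ^ 2 * (κ * δ₁ ^ 2 / 2) ^ 2) ≤ C ∧
      C₁ * (1 + M) ^ 2 + 1 ≤ C ∧ (1 + M) / δ₂ ≤ C ∧ 1 / δ ^ 2 ≤ C := by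
    have h1 : 0 < C₁ * K ^ 2 + 1 := by positivity
    have h2 : 0 < K ^ 2 / (κ ^ 2 * δ₂ ^ 2) := by positivity
    have h3 : 0 < 1 / (κ ^ 2 * (κ * δ₁ ^ 2 / 2) ^ 2) := by positivity
    have h4 : 0 < C₁ * (1 + M) ^ 2 + 1 := by positivity
    have h5 : 0 < (1 + M) / δ₂ := by positivity
    have h6 : 0 < 1 / δ ^ 2 := by positivity
    refine ⟨(C₁ * K ^ 2 + 1) + K ^ 2 / (κ ^ 2 * δ₂ ^ 2) + 1 / (κ ^ 2 * (κ * δ₁ ^ 2 / 2) ^ 2) +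
      (C₁ * (1 + M) ^ 2 + 1) + (1 + M) / δ₂ + 1 / δ ^ 2, ?_, ?_, ?_, ?_, ?_, ?_, ?_⟩ <;> linarith
  refine ⟨g, C, hC0, hgd, ?_, ?_, ?_⟩
  · intro w w' z h h' heq
    have hle : ∀ w, (w, z) ∈ U → κ * ‖z‖ ^ 2 ≤ w.re := fun w h => by
      have := hU w z h
      have : 0 ≤ κ * ‖w‖ ^ 2 := by positivity
      linarith
    have h1 := hlip w w' z (hle w h) (hle w' h')
    have h2 : Λ z z * g w - Λ z z * g w' = w - w' := by linear_combination -heq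
    rw [h2] at h1
    have h3 : ‖w - w'‖ ≤ 0 := by linarith
    exact sub_eq_zero.1 (norm_le_zero_iff.1 h3)
  · intro w z h
    obtain ⟨hre, hw0, -, -, hz1⟩ := hbd w z h
    have hz2 : ‖z‖ ^ 2 < 1 / κ ^ 2 := by rw [lt_div_iff₀ (by positivity)]; linarith
    have hz3 : (1 - ε) * ‖z‖ ^ 2 ≤ ‖z‖ ^ 2 := by nlinarith [sq_nonneg ‖z‖]
    rcases lt_or_ge ‖w‖ δ₁ with hw | hw
    · obtain ⟨h1, h2, h3⟩ := hloc w z h hw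
      have h3' : ‖w‖ ^ 2 ≤ K ^ 2 * ‖w - Λ z z * g w‖ ^ 2 := by
        rw [← mul_pow]; gcongr
      have h4 : C₁ * ‖w‖ ^ 2 ≤ C₁ * K ^ 2 * ‖w - Λ z z * g w‖ ^ 2 := by
        rw [mul_assoc]; gcongr
      have hn0 : 0 < ‖w - Λ z z * g w‖ := by
        by_contra! hcon
        nlinarith
      have hn2 : 0 < ‖w - Λ z z * g w‖ ^ 2 := by positivity
      rcases lt_or_ge ‖w‖ δ₂ with hw2 | hw2
      · have h5 := (abs_le.1 (hPg1 w z hre.le hw2)).2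
        have h6 : η * ‖z‖ ^ 2 ≤ ε / 2 * ‖z‖ ^ 2 := by gcongr
        have h7 := mul_le_mul_of_nonneg_right hCK hn2.le
        rw [Complex.sub_re] at *
        nlinarith
      · have h5 : δ₂ ^ 2 ≤ K ^ 2 * ‖w - Λ z z * g w‖ ^ 2 := le_trans (by gcongr) h3'
        have h6 : 1 / κ ^ 2 ≤ (C - C₁ * K ^ 2) * ‖w - Λ z z * g w‖ ^ 2 := by
          calc 1 / κ ^ 2 = K ^ 2 / (κ ^ 2 * δ₂ ^ 2) * (δ₂ ^ 2 / K ^ 2) := by field_simp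
            _ ≤ _ := by
              refine mul_le_mul hCδ₂ ?_ (by positivity) (by linarith)
              rw [div_le_iff₀ (by positivity)]
              linarith
        have h7 : 0 ≤ κ / 2 * ‖z‖ ^ 2 := by positivity
        nlinarith
    · have h1 := hfar w z h hw
      have hpos : 0 < κ * δ₁ ^ 2 / 2 := by positivity
      have h2 : (κ * δ₁ ^ 2 / 2) ^ 2 ≤ ‖w - Λ z z * g w‖ ^ 2 := by
        gcongr
        exact h1.trans (Complex.re_le_norm _)
      have h3 : 1 / κ ^ 2 ≤ C * ‖w - Λ z z * g w‖ ^ 2 := by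
        calc 1 / κ ^ 2 =
            1 / (κ ^ 2 * (κ * δ₁ ^ 2 / 2) ^ 2) * (κ * δ₁ ^ 2 / 2) ^ 2 := by field_simp
          _ ≤ _ := mul_le_mul hCδ₁ h2 (by positivity) hC0.le
      linarith
  · intro w' z h
    have hre' : 0 < w'.re := lt_of_le_of_lt (by positivity) h
    have hle := Complex.re_le_norm w'
    have hn' : 0 < ‖w'‖ := hre'.trans_le hle
    have hZ : ‖z‖ ^ 2 < ‖w'‖ := by
      have : 0 ≤ ε * ‖z‖ ^ 2 := by positivity
      have : 0 ≤ C * ‖w'‖ ^ 2 := by positivity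
      linarith
    have hCw : C * ‖w'‖ < 1 := by
      by_contra! hcon
      have := mul_le_mul_of_nonneg_right hcon hn'.le
      have : 0 ≤ (1 + ε) * ‖z‖ ^ 2 := by positivity
      nlinarith
    set s : Set ℂ := {u | max (κ * ‖z‖ ^ 2) 0 ≤ u.re} with hs
    set f : ℂ → ℂ := fun u => w' + Λ z z * g u with hf
    have hmem : ∀ u, u ∈ s ↔ κ * ‖z‖ ^ 2 ≤ u.re := fun u => by
      rw [hs, Set.mem_ofPred_eq, max_eq_left (by positivity)]
    have hs0 : ∀ u ∈ s, 0 ≤ u.re := fun u hu => (le_max_right _ _).trans hu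
    have hmaps : MapsTo f s s := by
      intro u hu
      rw [hmem]
      have h1 := (abs_le.1 (hPg u z (hs0 u hu))).1
      have h2 := hmix ‖g u‖ z (norm_nonneg _) (hg1 u (hs0 u hu))
      have h3 : a * M * ‖z‖ ^ 2 ≤ ε / 2 * ‖z‖ ^ 2 := by gcongr
      have h4 : 0 ≤ ε / 2 * ‖z‖ ^ 2 := by positivity
      have h5 : 0 ≤ C * ‖w'‖ ^ 2 := by positivity
      simp only [hf, Complex.add_re]
      nlinarith
    have hcontr : ContractingWith (1 / 2 : NNReal) (MapsTo.restrict f s s hmaps) := by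
      refine ⟨by rw [← NNReal.coe_lt_coe]; norm_num, LipschitzWith.of_dist_le_mul ?_⟩
      rintro ⟨u, hu⟩ ⟨v, hv⟩
      have := hlip u v z ((hmem u).1 hu) ((hmem v).1 hv)
      rw [Subtype.dist_eq, Subtype.dist_eq, dist_eq_norm, dist_eq_norm]
      simpa [hf, MapsTo.restrict] using this
    have hclosed : IsClosed s := isClosed_le continuous_const Complex.continuous_re
    have hstart : w' ∈ s := by
      rw [hmem]
      have : 0 ≤ ε * ‖z‖ ^ 2 := by positivity
      have : 0 ≤ C * ‖w'‖ ^ 2 := by positivity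
      have : κ * ‖z‖ ^ 2 ≤ 1 * ‖z‖ ^ 2 := by gcongr
      linarith
    obtain ⟨u, hu, hfix, -⟩ := hcontr.exists_fixedPoint' hclosed.isComplete hmaps hstart
      (edist_ne_top _ _)
    have hfix' : w' + Λ z z * g u = u := hfix
    have hu0 := hs0 u hu
    refine ⟨u, ?_, by linear_combination -hfix'⟩
    have hun : ‖u‖ ≤ (1 + M) * ‖w'‖ := by
      calc ‖u‖ = ‖w' + Λ z z * g u‖ := by rw [hfix']
        _ ≤ ‖w'‖ + M * ‖z‖ ^ 2 := (norm_add_le _ _).trans (by gcongr; exact hPn u z hu0)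
        _ ≤ ‖w'‖ + M * ‖w'‖ := by gcongr
        _ = _ := by ring
    have huδ₂ : ‖u‖ < δ₂ := by
      rw [div_le_iff₀ hδ₂0] at hCM
      have h1 : C * ‖u‖ ≤ (1 + M) * (C * ‖w'‖) := by
        calc C * ‖u‖ ≤ C * ((1 + M) * ‖w'‖) := by gcongr
          _ = _ := by ring
      have h2 : (1 + M) * (C * ‖w'‖) < (1 + M) * 1 := by gcongr
      exact lt_of_mul_lt_mul_left (by linarith) hC0.le
    have hzδ : ‖z‖ < δ := by
      refine lt_of_pow_lt_pow_left₀ 2 hδ.le ?_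
      rw [div_le_iff₀ (by positivity)] at hCδ
      refine lt_of_mul_lt_mul_left (a := C) ?_ hC0.le
      nlinarith
    refine (hT u z (huδ₂.trans_le (hδ₂1.trans hδ₁δ)) hzδ).2 ?_
    have h1 := (abs_le.1 (hPg1 u z hu0 huδ₂)).1
    have h2 : u.re = w'.re + (Λ z z * g u).re := by rw [← Complex.add_re, hfix']
    have h3 : η * ‖z‖ ^ 2 ≤ ε / 2 * ‖z‖ ^ 2 := by gcongr
    have h4 : C₁ * ‖u‖ ^ 2 ≤ C₁ * (1 + M) ^ 2 * ‖w'‖ ^ 2 := by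
      rw [mul_assoc, ← mul_pow]; gcongr
    have h5 : C₁ * (1 + M) ^ 2 * ‖w'‖ ^ 2 ≤ C * ‖w'‖ ^ 2 := by gcongr; linarith
    linarith

/-- A projective transformation mapping the domain `{(1 - ε)‖z‖² < Re w + C‖w‖²}` into the unit ball
and the domain `{(1 + ε)‖z‖² + C‖w‖² < Re w}` onto a set containing a given smaller ball. -/
lemma exists_projective_map {F : Type*} [NormedAddCommGroup F] [NormedSpace ℂ F]
    (C ε r : ℝ) (hC : 0 < C) (hε : 0 < ε) (hε1 : ε < 1) (hr : 0 ≤ r) (hr1 : r < 1)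
    (hεr : (1 + ε) * r ^ 2 < 1 - ε) :
    ∃ (α β γ s : ℂ), s ≠ 0 ∧
      (∀ (w : ℂ) (z : F), (1 - ε) * ‖z‖ ^ 2 < w.re + C * ‖w‖ ^ 2 → α + γ * w ≠ 0 ∧
        ‖(α + β * w) / (α + γ * w)‖ ^ 2 + ‖(s / (α + γ * w)) • z‖ ^ 2 < 1) ∧
      (∀ w w' : ℂ, α + γ * w ≠ 0 → α + γ * w' ≠ 0 →
        (α + β * w) / (α + γ * w) = (α + β * w') / (α + γ * w') → w = w') ∧
      (∀ (u : ℂ) (v : F), ‖u‖ ^ 2 + ‖v‖ ^ 2 ≤ r ^ 2 → ∃ (w : ℂ) (z : F),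
        (1 + ε) * ‖z‖ ^ 2 + C * ‖w‖ ^ 2 < w.re ∧
          (α + β * w) / (α + γ * w) = u ∧ (s / (α + γ * w)) • z = v) := by
  obtain ⟨t, ht, ht1, ht2⟩ : ∃ t : ℝ, 0 < t ∧ t * C * 2 < 1 - r ∧
      (1 + ε) * r ^ 2 + 8 * (t * C) < 1 - ε := by
    have h : 0 < min (1 - r) (1 - ε - (1 + ε) * r ^ 2) := lt_min (by linarith) (by linarith)
    set m := min (1 - r) (1 - ε - (1 + ε) * r ^ 2)
    have h1 : m ≤ 1 - r := min_le_left _ _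
    have h2 : m ≤ 1 - ε - (1 + ε) * r ^ 2 := min_le_right _ _
    have h3 : m / (16 * C) * C = m / 16 := by field_simp
    refine ⟨m / (16 * C), by positivity, ?_, ?_⟩ <;> rw [h3] <;> linarith
  set s : ℝ := √(t * (1 - ε)) with hs
  have hε0 : 0 < 1 - ε := by linarith
  have hs0 : 0 < s := Real.sqrt_pos.2 (by positivity)
  have hs2 : s ^ 2 = t * (1 - ε) := Real.sq_sqrt (by positivity)
  refine ⟨t, t * C - 1, t * C + 1, 2 * s, by simpa using hs0.ne', ?_, ?_, ?_⟩
  · intro w z h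
    have key : ‖(t : ℂ) + (t * C + 1) * w‖ ^ 2 - ‖(t : ℂ) + (t * C - 1) * w‖ ^ 2 =
        4 * t * (w.re + C * ‖w‖ ^ 2) := by
      simp only [Complex.sq_norm, Complex.normSq_apply, Complex.add_re, Complex.add_im,
        Complex.mul_re, Complex.mul_im, Complex.sub_re, Complex.sub_im, Complex.ofReal_re,
        Complex.ofReal_im, Complex.one_re, Complex.one_im]
      ring
    have h0 : 0 ≤ (1 - ε) * ‖z‖ ^ 2 := by positivity
    have h1 : 0 < 4 * t * (w.re + C * ‖w‖ ^ 2 - (1 - ε) * ‖z‖ ^ 2) := by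
      have : 0 < w.re + C * ‖w‖ ^ 2 - (1 - ε) * ‖z‖ ^ 2 := by linarith
      positivity
    have hne : (t : ℂ) + (t * C + 1) * w ≠ 0 := by
      intro h2
      rw [h2] at key
      simp only [norm_zero] at key
      nlinarith [sq_nonneg ‖(t : ℂ) + (t * C - 1) * w‖]
    refine ⟨hne, ?_⟩
    have hd : 0 < ‖(t : ℂ) + (t * C + 1) * w‖ := norm_pos_iff.2 hne
    rw [norm_smul, norm_div, norm_div, norm_mul, Complex.norm_real, Real.norm_of_nonneg hs0.le,
      Complex.norm_two, mul_pow, div_pow, div_pow, mul_pow, hs2, div_mul_eq_mul_div, ← add_div,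
      div_lt_one (by positivity)]
    nlinarith
  · intro w w' h h' heq
    rw [div_eq_div_iff h h'] at heq
    have h1 : (2 * (t : ℂ)) * (w - w') = 0 := by linear_combination -heq
    have h2 : (2 * (t : ℂ)) ≠ 0 := by simpa using ht.ne'
    exact sub_eq_zero.1 ((mul_eq_zero.1 h1).resolve_left h2)
  · intro u v huv
    have hu : ‖u‖ ≤ r := by
      refine le_of_sq_le_sq ?_ hr
      nlinarith [sq_nonneg ‖v‖]
    have h1u : ‖1 - u‖ ≤ 2 := by
      calc ‖1 - u‖ ≤ ‖(1 : ℂ)‖ + ‖u‖ := norm_sub_le _ _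
        _ ≤ 2 := by rw [norm_one]; linarith
    set d : ℂ := (1 + u) - t * C * (1 - u) with hd
    have hd0 : d ≠ 0 := by
      intro h
      have h2 : (1 : ℂ) = -u + t * C * (1 - u) := by
        rw [hd] at h; linear_combination h
      have h3 : (1 : ℝ) ≤ ‖u‖ + t * C * ‖1 - u‖ := by
        calc (1 : ℝ) = ‖(1 : ℂ)‖ := norm_one.symm
          _ = ‖-u + t * C * (1 - u)‖ := by rw [← h2]
          _ ≤ ‖-u‖ + ‖t * C * (1 - u)‖ := norm_add_le _ _
          _ = _ := by
            rw [norm_neg, norm_mul, norm_mul, Complex.norm_real, Complex.norm_real,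
              Real.norm_of_nonneg ht.le, Real.norm_of_nonneg hC.le]
      have h4 : t * C * ‖1 - u‖ ≤ t * C * 2 := by gcongr
      linarith
    have ht0 : (t : ℂ) ≠ 0 := by simpa using ht.ne'
    have hs0' : (s : ℂ) ≠ 0 := by simpa using hs0.ne'
    have hden : (t : ℂ) + (t * C + 1) * (t * (1 - u) / d) = 2 * t / d := by
      field_simp; rw [hd]; ring
    have hnum : (t : ℂ) + (t * C - 1) * (t * (1 - u) / d) = 2 * t * u / d := by
      field_simp; rw [hd]; ring
    refine ⟨t * (1 - u) / d, (t / (s * d)) • v, ?_, ?_, ?_⟩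
    · have hdp : 0 < ‖d‖ := norm_pos_iff.2 hd0
      have hre : (t * (1 - u) / d).re =
          (t * (1 - ‖u‖ ^ 2) - t * (t * C) * ‖1 - u‖ ^ 2) / ‖d‖ ^ 2 := by
        rw [Complex.div_re, Complex.sq_norm, Complex.sq_norm, Complex.sq_norm, ← add_div]
        congr 1
        rw [hd]
        simp only [Complex.normSq_apply, Complex.add_re, Complex.add_im,
          Complex.mul_re, Complex.mul_im, Complex.sub_re, Complex.sub_im, Complex.ofReal_re,
          Complex.ofReal_im, Complex.one_re, Complex.one_im]
        ring
      rw [hre, norm_smul, norm_div, norm_div, norm_mul, norm_mul, Complex.norm_real,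
        Complex.norm_real, Real.norm_of_nonneg ht.le, Real.norm_of_nonneg hs0.le, mul_pow, div_pow,
        div_pow, mul_pow, mul_pow, hs2, lt_div_iff₀ (by positivity)]
      have h5 : ((1 + ε) * (t ^ 2 / (t * (1 - ε) * ‖d‖ ^ 2) * ‖v‖ ^ 2) +
          C * (t ^ 2 * ‖1 - u‖ ^ 2 / ‖d‖ ^ 2)) * ‖d‖ ^ 2 =
          t * ((1 + ε) * ‖v‖ ^ 2 / (1 - ε) + t * C * ‖1 - u‖ ^ 2) := by
        field_simp
      rw [h5]
      have h6 : ‖1 - u‖ ^ 2 ≤ 2 ^ 2 := by gcongr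
      have h7 : t * C * ‖1 - u‖ ^ 2 ≤ t * C * 2 ^ 2 := by gcongr
      have h8 : (1 + ε) * ‖v‖ ^ 2 / (1 - ε) < 1 - ‖u‖ ^ 2 - 8 * (t * C) := by
        rw [div_lt_iff₀ hε0]
        have h9 : (1 + ε) * (‖u‖ ^ 2 + ‖v‖ ^ 2) ≤ (1 + ε) * r ^ 2 := by gcongr
        have h10 : 0 ≤ t * C := by positivity
        nlinarith [sq_nonneg ‖u‖]
      have h11 : (1 + ε) * ‖v‖ ^ 2 / (1 - ε) + t * C * ‖1 - u‖ ^ 2 <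
          1 - ‖u‖ ^ 2 - t * C * ‖1 - u‖ ^ 2 := by linarith
      calc _ < t * (1 - ‖u‖ ^ 2 - t * C * ‖1 - u‖ ^ 2) := by gcongr
        _ = _ := by ring
    · rw [hden, hnum]; field_simp
    · rw [hden, smul_smul]
      convert one_smul ℂ v using 2
      field_simp

/-- A positive definite real quadratic form on a complex inner product space is the sum of a
Hermitian square and the real part of a complex quadratic form. -/
lemma exists_hermitian_add_pluriharmonic {F : Type*} [NormedAddCommGroup F]
    [InnerProductSpace ℂ F] [FiniteDimensional ℂ F] (B : F →L[ℝ] F →L[ℝ] ℝ)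
    (hB : ∀ x y, B x y = B y x) (hpos : ∀ x, x ≠ 0 → 0 < B x x) :
    ∃ (A : F ≃L[ℂ] F) (Λ : F →L[ℂ] F →L[ℂ] ℂ),
      ∀ z, B z z = ‖A z‖ ^ 2 + (Λ z z).re := by
  have : CompleteSpace F := FiniteDimensional.complete ℂ F
  let _ : InnerProductSpace ℝ F := InnerProductSpace.complexToReal
  set b : F → F := fun x => (InnerProductSpace.toDual ℝ F).symm (B x) with hb
  have hbr : ∀ x y, (inner ℂ (b x) y).re = B x y := fun x y => by
    have h : inner ℝ (b x) y = B x y := by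
      simp only [hb]; rw [InnerProductSpace.toDual_symm_apply]
    rw [← h, real_inner_eq_re_inner ℂ]; rfl
  have hbadd : ∀ x y, b (x + y) = b x + b y := fun x y => by simp [hb]
  have hbsmul : ∀ (r : ℝ) x, b ((r : ℂ) • x) = (r : ℂ) • b x := fun r x => by
    simp [hb]
  have hbneg : ∀ x, b (-x) = - b x := fun x => by simp [hb]
  have hbI : ∀ x, b (Complex.I • Complex.I • x) = - b x := fun x => by
    rw [smul_smul, Complex.I_mul_I, neg_one_smul, hbneg]
  -- complex linear part
  let T : F →ₗ[ℂ] F :=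
    { toFun := fun x => (1 / 2 : ℂ) • (b x - Complex.I • b (Complex.I • x))
      map_add' := fun x y => by
        simp only [smul_add, hbadd]; module
      map_smul' := fun c x => by
        have h1 : b (c • x) = (c.re : ℂ) • b x + (c.im : ℂ) • b (Complex.I • x) := by
          conv_lhs => rw [← Complex.re_add_im c, add_smul, mul_smul, hbadd, hbsmul, hbsmul]
        have h2 : b (Complex.I • c • x) = (c.re : ℂ) • b (Complex.I • x) - (c.im : ℂ) • b x := by
          rw [smul_comm]
          conv_lhs => rw [← Complex.re_add_im c, add_smul, mul_smul, hbadd, hbsmul, hbsmul, hbI]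
          module
        simp only [RingHom.id_apply]
        rw [h1, h2]
        conv_rhs => rw [← Complex.re_add_im c]
        match_scalars <;> ring_nf <;> simp <;> ring }
  -- antilinear part
  let τ : F →ₗ⋆[ℂ] F :=
    { toFun := fun x => (1 / 2 : ℂ) • (b x + Complex.I • b (Complex.I • x))
      map_add' := fun x y => by
        simp only [smul_add, hbadd]; module
      map_smul' := fun c x => by
        have h1 : b (c • x) = (c.re : ℂ) • b x + (c.im : ℂ) • b (Complex.I • x) := by
          conv_lhs => rw [← Complex.re_add_im c, add_smul, mul_smul, hbadd, hbsmul, hbsmul]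
        have h2 : b (Complex.I • c • x) = (c.re : ℂ) • b (Complex.I • x) - (c.im : ℂ) • b x := by
          rw [smul_comm]
          conv_lhs => rw [← Complex.re_add_im c, add_smul, mul_smul, hbadd, hbsmul, hbsmul, hbI]
          module
        have h3 : (starRingEnd ℂ) c = c.re - c.im * Complex.I := by
          apply Complex.ext <;> simp
        rw [h1, h2, h3]
        match_scalars <;> ring_nf <;> simp <;> ring }
  have hTre : ∀ x y, (inner ℂ (T x) y).re =
      1 / 2 * (B x y + B (Complex.I • x) (Complex.I • y)) := by
    intro x y
    have h : inner ℂ (T x) y = (1 / 2 : ℂ) * (inner ℂ (b x) y +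
        inner ℂ (b (Complex.I • x)) (Complex.I • y)) := by
      simp only [T, LinearMap.coe_mk, AddHom.coe_mk, inner_smul_left, inner_sub_left,
        inner_smul_right]
      simp
      exact Or.inl (map_ofNat (starRingEnd ℂ) 2)
    rw [h]
    simp [← hbr]
  have hTsymm : T.IsSymmetric := by
    intro x y
    have hre : ∀ x y, (inner ℂ (T x) y).re = (inner ℂ x (T y)).re := by
      intro x y
      rw [← inner_conj_symm x (T y), Complex.conj_re, hTre, hTre, hB x y,
        hB (Complex.I • x) (Complex.I • y)]
    apply Complex.ext (hre x y)
    have h1 := hre x (Complex.I • y)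
    rw [map_smul, inner_smul_right, inner_smul_right] at h1
    simpa using h1
  let Tc : F →L[ℂ] F := LinearMap.toContinuousLinearMap T
  have hTpos : Tc.IsPositive := by
    refine ⟨hTsymm, fun x => ?_⟩
    change 0 ≤ (inner ℂ (T x) x).re
    rw [hTre]
    have h : ∀ x, 0 ≤ B x x := fun x => by
      rcases eq_or_ne x 0 with rfl | hx
      · simp
      · exact (hpos x hx).le
    linarith [h x, h (Complex.I • x)]
  let S : F →L[ℂ] F := CFC.sqrt Tc
  have hSS : S * S = Tc :=
    CFC.sqrt_mul_sqrt_self Tc ((ContinuousLinearMap.nonneg_iff_isPositive Tc).2 hTpos)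
  have hSsa : S.IsPositive := (ContinuousLinearMap.nonneg_iff_isPositive S).1 (CFC.sqrt_nonneg Tc)
  have hSnorm : ∀ x, ‖S x‖ ^ 2 = (inner ℂ (T x) x).re := by
    intro x
    have h1 : inner ℂ (S (S x)) x = inner ℂ (S x) (S x) := hSsa.1 (S x) x
    have h2 : S (S x) = T x := by
      change (S * S) x = T x
      rw [hSS]; rfl
    rw [← h2, h1, inner_self_eq_norm_sq_to_K]
    norm_cast
  have hSinj : Function.Injective (S : F →ₗ[ℂ] F) := by
    rw [injective_iff_map_eq_zero]
    intro x hx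
    by_contra hne
    have h1 := hSnorm x
    have h0 : S x = 0 := hx
    rw [h0, hTre] at h1
    have h2 := hpos x hne
    have h3 := hpos (Complex.I • x) (smul_ne_zero Complex.I_ne_zero hne)
    simp at h1
    linarith
  let Λ₀ : F →ₗ[ℂ] F →L[ℂ] ℂ :=
    { toFun := fun x => innerSL ℂ (τ x)
      map_add' := fun x y => by simp
      map_smul' := fun c x => by
        rw [map_smulₛₗ, map_smulₛₗ]; simp }
  refine ⟨(LinearEquiv.ofInjectiveEndo (S : F →ₗ[ℂ] F) hSinj).toContinuousLinearEquiv,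
    LinearMap.toContinuousLinearMap Λ₀, fun z => ?_⟩
  have h1 : (LinearEquiv.ofInjectiveEndo (S : F →ₗ[ℂ] F) hSinj).toContinuousLinearEquiv z = S z :=
    rfl
  have h2 : LinearMap.toContinuousLinearMap Λ₀ z z = inner ℂ (τ z) z := rfl
  have h3 : b z = T z + τ z := by
    simp only [T, τ, LinearMap.coe_mk, AddHom.coe_mk]; module
  rw [h1, h2, hSnorm, ← Complex.add_re, ← inner_add_left, ← h3, hbr]

/-- Second order Taylor expansion of a `C²` function. -/
lemma exists_taylor_two {E : Type*} [NormedAddCommGroup E] [NormedSpace ℝ E] (ρ : E → ℝ) (p : E)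
    (hρ : ContDiffAt ℝ 2 ρ p) (η : ℝ) (hη : 0 < η) :
    ∃ δ > 0, ∀ v, ‖v‖ < δ →
      |ρ (p + v) - ρ p - fderiv ℝ ρ p v - 1 / 2 * fderiv ℝ (fderiv ℝ ρ) p v v| ≤ η * ‖v‖ ^ 2 := by
  set B := fderiv ℝ (fderiv ℝ ρ) p with hBdef
  have hsymm : ∀ x y, B x y = B y x := hρ.isSymmSndFDerivAt (by simp)
  have hd1 : ∀ᶠ x in nhds p, DifferentiableAt ℝ ρ x := by
    filter_upwards [hρ.eventually (by simp)] with x hx using hx.differentiableAt (by simp)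
  have hd2 : HasFDerivAt (fderiv ℝ ρ) B p :=
    ((hρ.fderiv_right (m := 1) (by norm_num)).differentiableAt (by simp)).hasFDerivAt
  have hev := (hd2.isLittleO.def hη).and hd1
  obtain ⟨δ, hδ, hball⟩ := Metric.eventually_nhds_iff_ball.1 hev
  refine ⟨δ, hδ, fun v hv => ?_⟩
  set h : E → ℝ := fun u => ρ (p + u) - ρ p - fderiv ℝ ρ p u - 1 / 2 * B u u with hh
  have hmem : ∀ u, ‖u‖ ≤ ‖v‖ → p + u ∈ ball p δ := fun u hu => by
    rw [mem_ball, dist_eq_norm, add_sub_cancel_left]; exact hu.trans_lt hv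
  have hderiv : ∀ u, ‖u‖ ≤ ‖v‖ →
      HasFDerivAt h (fderiv ℝ ρ (p + u) - fderiv ℝ ρ p - B u) u := by
    intro u hu
    have h1 : HasFDerivAt (fun u => ρ (p + u)) (fderiv ℝ ρ (p + u)) u := by
      have := (hball _ (hmem u hu)).2.hasFDerivAt
      exact (hasFDerivAt_comp_add_left p).2 this
    have h2 : HasFDerivAt (fun u => B u u) (B u + B.flip u) u := by
      exact ((B.hasFDerivAt (x := u)).clm_apply (hasFDerivAt_id u)).congr_fderiv
        (by ext y; simp)
    have h3 := ((h1.sub_const (ρ p)).sub (fderiv ℝ ρ p).hasFDerivAt).sub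
      (h2.const_mul (1 / 2 : ℝ))
    refine h3.congr_fderiv (ContinuousLinearMap.ext fun y => ?_)
    simp [hsymm y u]
    ring
  have hbound : ∀ u ∈ closedBall (0 : E) ‖v‖, ‖fderiv ℝ h u‖ ≤ η * ‖v‖ := by
    intro u hu
    have hu' : ‖u‖ ≤ ‖v‖ := by simpa using hu
    rw [(hderiv u hu').fderiv]
    have := (hball _ (hmem u hu')).1
    rw [add_sub_cancel_left] at this
    exact this.trans (by gcongr)
  have key := Convex.norm_image_sub_le_of_norm_fderiv_le (𝕜 := ℝ) (f := h)
    (s := closedBall (0 : E) ‖v‖) (x := 0) (y := v)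
    (fun u hu => (hderiv u (by simpa using hu)).differentiableAt) hbound
    (convex_closedBall _ _) (by simp) (by simp)
  have h0 : h 0 = 0 := by simp [hh]
  rw [h0, sub_zero, sub_zero, Real.norm_eq_abs] at key
  calc _ ≤ _ := key
    _ = _ := by ring

/-- Near a `C²` boundary point at which `Ω` is contained in a ball with inner normal `e`, `Ω` is to
second order the domain above a quadratic graph. -/
lemma exists_quadratic_graph {E : Type*} [NormedAddCommGroup E] [InnerProductSpace ℂ E]
    [NormedSpace ℝ E] [IsScalarTower ℝ ℂ E]
    (Ω : Set E) (hopen : IsOpen Ω) (p : E) (hp : p ∈ frontier Ω) (r₀ : ℝ) (hr₀ : 0 < r₀)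
    (ρ : E → ℝ) (hρ : ContDiffOn ℝ 2 ρ (ball p r₀)) (hgrad : fderiv ℝ ρ p ≠ 0)
    (hdef : Ω ∩ ball p r₀ = {x | ρ x < 0} ∩ ball p r₀)
    (e : E) (he : ‖e‖ = 1) (hΩ : ∀ v, p + v ∈ Ω → 0 ≤ (inner ℂ e v).re) :
    ∃ B : E →L[ℝ] E →L[ℝ] ℝ, (∀ x y, B x y = B y x) ∧ ∀ η : ℝ, 0 < η → ∃ δ > 0, ∀ v, ‖v‖ < δ →
      (p + v ∈ Ω → B v v - η * ‖v‖ ^ 2 ≤ (inner ℂ e v).re) ∧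
      (B v v + η * ‖v‖ ^ 2 < (inner ℂ e v).re → p + v ∈ Ω) := by
  have hcd : ContDiffAt ℝ 2 ρ p := hρ.contDiffAt (ball_mem_nhds p hr₀)
  have hmem : ∀ x ∈ ball p r₀, (x ∈ Ω ↔ ρ x < 0) := fun x hx => by
    have := Set.ext_iff.1 hdef x
    simpa [hx] using this
  have hp0 : ρ p = 0 := by
    apply le_antisymm
    · by_contra! hcon
      have h1 : ∀ᶠ x in nhds p, 0 < ρ x := hcd.continuousAt.eventually (lt_mem_nhds hcon)
      have h2 : ∃ᶠ x in nhds p, x ∈ Ω := mem_closure_iff_frequently.1 hp.1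
      obtain ⟨x, hx, hx1, hx2⟩ := (h2.and_eventually (h1.and (ball_mem_nhds p hr₀))).exists
      exact absurd ((hmem x hx2).1 hx) (by linarith)
    · by_contra! hcon
      have : p ∈ Ω := (hmem p (mem_ball_self hr₀)).2 hcon
      rw [hopen.frontier_eq] at hp
      exact hp.2 this
  set ℓ := fderiv ℝ ρ p with hℓ
  have hneg : ∀ v, ℓ v < 0 → 0 ≤ (inner ℂ e v).re := by
    intro v hv
    have hder : HasDerivAt (fun t : ℝ => ρ (p + t • v)) (ℓ v) 0 := by
      have h1 : HasFDerivAt ρ ℓ (p + (0 : ℝ) • v) := by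
        rw [zero_smul, add_zero]; exact (hcd.differentiableAt (by simp)).hasFDerivAt
      have h2 : HasDerivAt (fun t : ℝ => p + t • v) v 0 := by
        simpa using ((hasDerivAt_id (0 : ℝ)).smul_const v).const_add p
      exact h1.comp_hasDerivAt 0 h2
    have h1 := hder.tendsto_slope_zero_right
    have h2 := h1.eventually (gt_mem_nhds hv)
    have h3 : ∀ᶠ t : ℝ in nhdsWithin 0 (Ioi 0), p + t • v ∈ ball p r₀ := by
      have : Filter.Tendsto (fun t : ℝ => p + t • v) (nhds 0) (nhds p) := by
        have : Continuous (fun t : ℝ => p + t • v) := by fun_prop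
        simpa using this.tendsto 0
      exact (this.mono_left nhdsWithin_le_nhds).eventually (ball_mem_nhds p hr₀)
    obtain ⟨t, ⟨ht1, ht2⟩, ht0⟩ := ((h2.and h3).and self_mem_nhdsWithin).exists
    have ht0 : 0 < t := ht0
    have h4 : ρ (p + t • v) < 0 := by
      simp only [zero_add, zero_smul, add_zero, hp0, sub_zero, smul_eq_mul] at ht1
      by_contra! hcon
      have : 0 ≤ t⁻¹ * ρ (p + t • v) := by positivity
      linarith
    have h5 := hΩ _ ((hmem _ ht2).2 h4)
    rw [← algebraMap_smul ℂ t v, inner_smul_right] at h5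
    simp at h5
    exact nonneg_of_mul_nonneg_right h5 ht0
  have hinner_smul : ∀ (r : ℝ) (x : E), (inner ℂ e (r • x)).re = r * (inner ℂ e x).re := by
    intro r x
    rw [← algebraMap_smul ℂ r x, inner_smul_right]
    simp
  have hee : (inner ℂ e e).re = 1 := by
    rw [inner_self_eq_norm_sq_to_K, he]; simp
  have hker' : ∀ v, (inner ℂ e v).re = 0 → 0 ≤ ℓ v := by
    intro v hv
    by_contra! hcon
    obtain ⟨s, hs0, hs⟩ : ∃ s : ℝ, 0 < s ∧ ℓ v - s * ℓ e < 0 := by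
      refine ⟨-ℓ v / (2 * (|ℓ e| + 1)), by apply div_pos <;> [linarith; positivity], ?_⟩
      have h1 : -ℓ v / (2 * (|ℓ e| + 1)) * (|ℓ e| + 1) = -ℓ v / 2 := by
        have : |ℓ e| + 1 ≠ 0 := by positivity
        field_simp
      have h2 : 0 < -ℓ v / (2 * (|ℓ e| + 1)) := by apply div_pos <;> [linarith; positivity]
      nlinarith [neg_abs_le (ℓ e)]
    have h1 := hneg (v - s • e) (by simpa using hs)
    rw [inner_sub_right, Complex.sub_re, hinner_smul, hee, hv] at h1
    linarith
  have hker : ∀ v, (inner ℂ e v).re = 0 → ℓ v = 0 := by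
    intro v hv
    have h1 := hker' v hv
    have h2 := hker' (-v) (by rw [inner_neg_right, Complex.neg_re, hv, neg_zero])
    rw [map_neg] at h2
    linarith
  have hℓe : ∀ v, ℓ v = (inner ℂ e v).re * ℓ e := by
    intro v
    have h1 := hker (v - (inner ℂ e v).re • e) (by
      rw [inner_sub_right, Complex.sub_re, hinner_smul, hee]; ring)
    rw [map_sub, map_smul, smul_eq_mul] at h1
    linarith
  have hlt : ℓ e < 0 := by
    rcases lt_trichotomy (ℓ e) 0 with h | h | h
    · exact h
    · exact absurd (ContinuousLinearMap.ext fun v => by rw [hℓe, h]; simp) hgrad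
    · have := hneg (-e) (by rw [map_neg]; linarith)
      rw [inner_neg_right, Complex.neg_re, hee] at this
      linarith
  set l := -ℓ e with hl
  have hl0 : 0 < l := by linarith
  refine ⟨(1 / (2 * l)) • fderiv ℝ (fderiv ℝ ρ) p, fun x y => ?_, fun η hη => ?_⟩
  · have := hcd.isSymmSndFDerivAt (by simp) x y
    simp [this]
  · obtain ⟨δ, hδ, h⟩ := exists_taylor_two ρ p hcd (l * η) (by positivity)
    refine ⟨min δ r₀, lt_min hδ hr₀, fun v hv => ?_⟩
    have hv1 := h v (hv.trans_le (min_le_left _ _))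
    have hv2 : p + v ∈ ball p r₀ := by
      rw [mem_ball, dist_eq_norm, add_sub_cancel_left]
      exact hv.trans_le (min_le_right _ _)
    rw [hmem _ hv2]
    rw [← hℓ, hp0, hℓe v] at hv1
    have hv3 := abs_le.1 hv1
    set b := fderiv ℝ (fderiv ℝ ρ) p v v
    have hb : ((1 / (2 * l)) • fderiv ℝ (fderiv ℝ ρ) p) v v = b / (2 * l) := by
      simp [b]; ring
    have hb2 : l * (b / (2 * l)) = 1 / 2 * b := by field_simp
    rw [hb]
    refine ⟨fun hn => ?_, fun hn => ?_⟩
    · refine le_of_mul_le_mul_left ?_ hl0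
      nlinarith
    · have := mul_lt_mul_of_pos_left hn hl0
      nlinarith

/-- If the domain above a quadratic graph lies to second order in a ball, the quadratic form
dominates the one of the ball in the complex tangent directions. -/
lemma le_quadratic_form_of_graph {E : Type*} [NormedAddCommGroup E] [InnerProductSpace ℂ E]
    (Ω : Set E) (p e : E) (he : ‖e‖ = 1) (κ : ℝ) (hκ : 0 < κ)
    (hΩ : ∀ v, p + v ∈ Ω → κ * ‖v‖ ^ 2 < (inner ℂ e v).re)
    (B : E →L[ℝ] E →L[ℝ] ℝ)
    (hB : ∀ η : ℝ, 0 < η → ∃ δ > 0, ∀ v, ‖v‖ < δ →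
      (B v v + η * ‖v‖ ^ 2 < (inner ℂ e v).re → p + v ∈ Ω))
    (ζ : E) (hζ : inner ℂ e ζ = 0) : κ * ‖ζ‖ ^ 2 ≤ B ζ ζ := by
  by_contra! hcon
  set s : ℝ := (B ζ ζ + κ * ‖ζ‖ ^ 2) / 2 with hs
  obtain ⟨η, hη, hηs⟩ : ∃ η : ℝ, 0 < η ∧ B ζ ζ + η * ‖ζ‖ ^ 2 < s := by
    refine ⟨(κ * ‖ζ‖ ^ 2 - B ζ ζ) / 2 / (‖ζ‖ ^ 2 + 1), by
      apply div_pos <;> [linarith; positivity], ?_⟩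
    have : (κ * ‖ζ‖ ^ 2 - B ζ ζ) / 2 / (‖ζ‖ ^ 2 + 1) * ‖ζ‖ ^ 2 <
        (κ * ‖ζ‖ ^ 2 - B ζ ζ) / 2 := by
      rw [div_mul_eq_mul_div, div_lt_iff₀ (by positivity)]
      nlinarith
    linarith
  obtain ⟨δ, hδ, h⟩ := hB η hη
  have hee : inner ℂ e e = 1 := by
    rw [inner_self_eq_norm_sq_to_K, he]; simp
  set γ : ℝ → E := fun t => t • (ζ + (t * s) • e) with hγ
  have hγc : Continuous γ := by fun_prop
  have h1 : ∀ᶠ t in nhdsWithin (0 : ℝ) (Ioi 0), ‖γ t‖ < δ := by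
    have : Filter.Tendsto (fun t => ‖γ t‖) (nhds 0) (nhds 0) := by
      simpa [hγ] using hγc.norm.tendsto 0
    exact (this.mono_left nhdsWithin_le_nhds).eventually (gt_mem_nhds hδ)
  have h2 : ∀ᶠ t in nhdsWithin (0 : ℝ) (Ioi 0),
      B (ζ + (t * s) • e) (ζ + (t * s) • e) + η * ‖ζ + (t * s) • e‖ ^ 2 < s := by
    have hc : Continuous (fun t : ℝ =>
        B (ζ + (t * s) • e) (ζ + (t * s) • e) + η * ‖ζ + (t * s) • e‖ ^ 2) := by fun_prop
    have := hc.tendsto 0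
    simp only [zero_mul, zero_smul, add_zero] at this
    exact (this.mono_left nhdsWithin_le_nhds).eventually (gt_mem_nhds hηs)
  obtain ⟨t, ⟨ht1, ht2⟩, ht0⟩ := ((h1.and h2).and self_mem_nhdsWithin).exists
  have ht0 : 0 < t := ht0
  have hinner : (inner ℂ e (γ t)).re = t ^ 2 * s := by
    have : γ t = (t : ℂ) • ζ + ((t * (t * s) : ℝ) : ℂ) • e := by
      simp only [hγ, Complex.coe_smul, smul_add, smul_smul]
    rw [this, inner_add_right, inner_smul_right, inner_smul_right, hζ, hee]
    simp; ring
  have hnorm : ‖γ t‖ ^ 2 = t ^ 2 * ‖ζ + (t * s) • e‖ ^ 2 := by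
    rw [hγ, norm_smul, mul_pow, Real.norm_eq_abs, sq_abs]
  have hn2 : ‖ζ‖ ^ 2 ≤ ‖ζ + (t * s) • e‖ ^ 2 := by
    have h0 : inner ℂ ζ (((t * s : ℝ) : ℂ) • e) = 0 := by
      rw [inner_smul_right, ← inner_conj_symm, hζ]; simp
    have := norm_add_sq_eq_norm_sq_add_norm_sq_of_inner_eq_zero _ _ h0
    rw [Complex.coe_smul] at this
    nlinarith [norm_nonneg ((t * s) • e)]
  have ht2' : 0 < t ^ 2 := by positivity
  have hmem := h (γ t) ht1 (by
    rw [hinner, hnorm]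
    have hBB : B (γ t) (γ t) = t ^ 2 * B (ζ + (t * s) • e) (ζ + (t * s) • e) := by
      simp only [hγ, map_smul, smul_apply, smul_eq_mul]; ring
    rw [hBB]
    have := mul_lt_mul_of_pos_left ht2 ht2'
    linarith)
  have h3 := hΩ _ hmem
  rw [hinner, hnorm] at h3
  have h4 : κ * ‖ζ + (t * s) • e‖ ^ 2 < s := by
    refine lt_of_mul_lt_mul_left ?_ ht2'.le
    linarith
  have h5 : κ * ‖ζ‖ ^ 2 ≤ κ * ‖ζ + (t * s) • e‖ ^ 2 := by gcongr
  rw [hs] at h4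
  linarith

/-- Coordinates in which a domain above a quadratic graph is normalized to second order up to a
pluriharmonic term. -/
lemma exists_normal_coordinates {E F : Type*} [NormedAddCommGroup E] [InnerProductSpace ℂ E]
    [NormedAddCommGroup F] [InnerProductSpace ℂ F] [FiniteDimensional ℂ F]
    (Ω : Set E) (p e : E) (he : ‖e‖ = 1) (j : F →ₗᵢ[ℂ] E) (hj : ∀ z, inner ℂ e (j z) = 0)
    (κ₀ : ℝ) (hκ₀ : 0 < κ₀)
    (hΩ : ∀ v, p + v ∈ Ω → κ₀ * ‖v‖ ^ 2 < (inner ℂ e v).re)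
    (B : E →L[ℝ] E →L[ℝ] ℝ) (hBs : ∀ x y, B x y = B y x)
    (hB : ∀ η : ℝ, 0 < η → ∃ δ > 0, ∀ v, ‖v‖ < δ →
      (p + v ∈ Ω → B v v - η * ‖v‖ ^ 2 ≤ (inner ℂ e v).re) ∧
      (B v v + η * ‖v‖ ^ 2 < (inner ℂ e v).re → p + v ∈ Ω)) :
    ∃ (A : F ≃L[ℂ] F) (Λ : F →L[ℂ] F →L[ℂ] ℂ) (κ : ℝ), 0 < κ ∧ κ ≤ 1 ∧
      (∀ z, κ * ‖z‖ ^ 2 ≤ ‖z‖ ^ 2 + (Λ z z).re) ∧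
      (∀ (w : ℂ) z, p + (w • e + j (A.symm z)) ∈ Ω → κ * (‖z‖ ^ 2 + ‖w‖ ^ 2) < w.re) ∧
      (∀ η : ℝ, 0 < η → ∃ C > 0, ∃ δ > 0, ∀ (w : ℂ) (z : F), ‖w‖ < δ → ‖z‖ < δ →
        (p + (w • e + j (A.symm z)) ∈ Ω →
          ‖z‖ ^ 2 + (Λ z z).re - η * ‖z‖ ^ 2 - C * ‖w‖ ^ 2 ≤ w.re) ∧
        (‖z‖ ^ 2 + (Λ z z).re + η * ‖z‖ ^ 2 + C * ‖w‖ ^ 2 < w.re →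
          p + (w • e + j (A.symm z)) ∈ Ω)) := by
  have hee : inner ℂ e e = 1 := by
    rw [inner_self_eq_norm_sq_to_K, he]; simp
  have hinner : ∀ (w : ℂ) (z : F), inner ℂ e (w • e + j z) = w := fun w z => by
    rw [inner_add_right, inner_smul_right, hee, hj, mul_one, add_zero]
  have hnorm : ∀ (w : ℂ) (z : F), ‖w • e + j z‖ ^ 2 = ‖z‖ ^ 2 + ‖w‖ ^ 2 := fun w z => by
    have h0 : inner ℂ (w • e) (j z) = 0 := by rw [inner_smul_left, hj, mul_zero]
    have := norm_add_sq_eq_norm_sq_add_norm_sq_of_inner_eq_zero _ _ h0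
    rw [norm_smul, he, mul_one, j.norm_map] at this
    linarith
  set ι : F →L[ℝ] E := j.toContinuousLinearMap.restrictScalars ℝ
  set BF : F →L[ℝ] F →L[ℝ] ℝ := B.bilinearComp ι ι with hBF
  have hBFapp : ∀ x y, BF x y = B (j x) (j y) := fun x y => rfl
  have hBFκ : ∀ z, κ₀ * ‖z‖ ^ 2 ≤ BF z z := fun z => by
    have := le_quadratic_form_of_graph Ω p e he κ₀ hκ₀ hΩ B (fun η hη => by
      obtain ⟨δ, hδ, h⟩ := hB η hη
      exact ⟨δ, hδ, fun v hv => (h v hv).2⟩) (j z) (hj z)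
    rwa [j.norm_map] at this
  obtain ⟨A, Λ₀, hA⟩ := exists_hermitian_add_pluriharmonic BF
    (fun x y => by rw [hBFapp, hBFapp, hBs]) (fun x hx => by
      have h1 := hBFκ x
      have h2 : 0 < ‖x‖ := norm_pos_iff.2 hx
      have : 0 < κ₀ * ‖x‖ ^ 2 := by positivity
      linarith)
  set Λ : F →L[ℂ] F →L[ℂ] ℂ :=
    Λ₀.bilinearComp (A.symm : F →L[ℂ] F) (A.symm : F →L[ℂ] F) with hΛ
  have hΛapp : ∀ z, B (j (A.symm z)) (j (A.symm z)) = ‖z‖ ^ 2 + (Λ z z).re := fun z => by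
    have := hA (A.symm z)
    rw [A.apply_symm_apply] at this
    exact this
  obtain ⟨a, ha1, ha⟩ : ∃ a : ℝ, 1 ≤ a ∧ ∀ z, ‖z‖ ≤ a * ‖A.symm z‖ := by
    refine ⟨‖(A : F →L[ℂ] F)‖ + 1, by linarith [norm_nonneg (A : F →L[ℂ] F)], fun z => ?_⟩
    have := (A : F →L[ℂ] F).le_opNorm (A.symm z)
    simp only [ContinuousLinearEquiv.coe_coe, ContinuousLinearEquiv.apply_symm_apply] at this
    nlinarith [norm_nonneg (A.symm z)]
  obtain ⟨b, hb1, hb⟩ : ∃ b : ℝ, 1 ≤ b ∧ ∀ z, ‖A.symm z‖ ≤ b * ‖z‖ := by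
    refine ⟨‖(A.symm : F →L[ℂ] F)‖ + 1, by linarith [norm_nonneg (A.symm : F →L[ℂ] F)],
      fun z => ?_⟩
    have := (A.symm : F →L[ℂ] F).le_opNorm z
    simp only [ContinuousLinearEquiv.coe_coe] at this
    nlinarith [norm_nonneg z]
  have hb0 : 0 < b := by linarith
  have ha0 : 0 < a := by linarith
  have hκa : ∀ z, κ₀ / a ^ 2 * ‖z‖ ^ 2 ≤ κ₀ * ‖A.symm z‖ ^ 2 := fun z => by
    calc κ₀ / a ^ 2 * ‖z‖ ^ 2 ≤ κ₀ / a ^ 2 * (a * ‖A.symm z‖) ^ 2 := by gcongr; exact ha z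
      _ = _ := by field_simp
  have hκ₀a : κ₀ / a ^ 2 ≤ κ₀ := div_le_self hκ₀.le (one_le_pow₀ ha1)
  set κ := min 1 (κ₀ / a ^ 2) with hκ
  have hκle : κ ≤ κ₀ / a ^ 2 := min_le_right _ _
  have hκz : ∀ z, κ * ‖z‖ ^ 2 ≤ κ₀ * ‖A.symm z‖ ^ 2 := fun z =>
    le_trans (by gcongr) (hκa z)
  refine ⟨A, Λ, κ, by positivity, min_le_left _ _, fun z => ?_, fun w z h => ?_, fun η hη => ?_⟩
  · rw [← hΛapp]
    exact (hκz z).trans (hBFκ _)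
  · have h1 := hΩ _ h
    rw [hinner, hnorm] at h1
    have h2 : κ * ‖w‖ ^ 2 ≤ κ₀ * ‖w‖ ^ 2 := by gcongr; linarith
    linarith [hκz z]
  · set η₁ := η / (2 * b ^ 2) with hη₁
    have hη₁0 : 0 < η₁ := by positivity
    obtain ⟨δ, hδ, h⟩ := hB η₁ hη₁0
    set β := ‖B‖ with hβ
    have hβ0 : 0 ≤ β := B.opNorm_nonneg
    refine ⟨β ^ 2 / η₁ + β + η₁, by positivity, δ / (2 * b), by positivity, fun w z hw hz => ?_⟩
    set v := w • e + j (A.symm z) with hv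
    have hvn := hnorm w (A.symm z)
    have hvδ : ‖v‖ < δ := by
      have h1 : ‖w‖ < δ / 2 := hw.trans_le (by
        apply div_le_div_of_nonneg_left hδ.le (by norm_num); linarith)
      have h2 : ‖j (A.symm z)‖ < δ / 2 := by
        rw [j.norm_map]
        calc _ ≤ b * ‖z‖ := hb z
          _ < b * (δ / (2 * b)) := by gcongr
          _ = δ / 2 := by field_simp
      calc ‖v‖ ≤ ‖w • e‖ + ‖j (A.symm z)‖ := norm_add_le _ _
        _ < δ := by rw [norm_smul, he, mul_one]; linarith
    have h1 := h v hvδ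
    rw [hinner, hvn] at h1
    have hBv : |B v v - (‖z‖ ^ 2 + (Λ z z).re)| ≤
        η₁ * ‖A.symm z‖ ^ 2 + (β ^ 2 / η₁ + β) * ‖w‖ ^ 2 := by
      have h2 : B v v - (‖z‖ ^ 2 + (Λ z z).re) =
          2 * B (w • e) (j (A.symm z)) + B (w • e) (w • e) := by
        rw [← hΛapp, hv]
        simp only [map_add, add_apply]
        rw [hBs (j (A.symm z)) (w • e)]
        ring
      have h3 : |B (w • e) (j (A.symm z))| ≤ β * ‖w‖ * ‖A.symm z‖ := by
        have := B.le_opNorm₂ (w • e) (j (A.symm z))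
        rwa [norm_smul, he, mul_one, j.norm_map] at this
      have h4 : |B (w • e) (w • e)| ≤ β * ‖w‖ * ‖w‖ := by
        have := B.le_opNorm₂ (w • e) (w • e)
        rwa [norm_smul, he, mul_one] at this
      have h5 : 2 * (β * ‖w‖ * ‖A.symm z‖) ≤
          η₁ * ‖A.symm z‖ ^ 2 + β ^ 2 / η₁ * ‖w‖ ^ 2 := by
        have h6 : 0 ≤ (η₁ * ‖A.symm z‖ - β * ‖w‖) ^ 2 / η₁ := by positivity
        have h7 : (η₁ * ‖A.symm z‖ - β * ‖w‖) ^ 2 / η₁ = η₁ * ‖A.symm z‖ ^ 2 +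
            β ^ 2 / η₁ * ‖w‖ ^ 2 - 2 * (β * ‖w‖ * ‖A.symm z‖) := by field_simp; ring
        linarith
      rw [h2]
      calc _ ≤ 2 * |B (w • e) (j (A.symm z))| + |B (w • e) (w • e)| := by
            refine (abs_add_le _ _).trans ?_
            rw [abs_mul, abs_two]
        _ ≤ _ := by nlinarith
    have hz2 : 2 * (η₁ * ‖A.symm z‖ ^ 2) ≤ η * ‖z‖ ^ 2 := by
      calc 2 * (η₁ * ‖A.symm z‖ ^ 2) ≤ 2 * (η₁ * (b * ‖z‖) ^ 2) := by gcongr; exact hb z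
        _ = η * ‖z‖ ^ 2 := by rw [hη₁]; field_simp
    have hBv' := abs_le.1 hBv
    refine ⟨fun hmem => ?_, fun hlt => h1.2 ?_⟩
    · have := h1.1 hmem
      linarith
    · linarith

/-- The maps of the exhaustion: for each smaller ball there is an embedding into the unit ball whose
image covers it. -/
lemma exists_embedding_covering_closedBall {E : Type*} [NormedAddCommGroup E]
    [InnerProductSpace ℂ E] [FiniteDimensional ℂ E] (Ω : Set E) (p e : E) (he : ‖e‖ = 1)
    (κ₀ : ℝ) (hκ₀ : 0 < κ₀)
    (hΩ : ∀ v, p + v ∈ Ω → κ₀ * ‖v‖ ^ 2 < (inner ℂ e v).re)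
    (B : E →L[ℝ] E →L[ℝ] ℝ) (hBs : ∀ x y, B x y = B y x)
    (hB : ∀ η : ℝ, 0 < η → ∃ δ > 0, ∀ v, ‖v‖ < δ →
      (p + v ∈ Ω → B v v - η * ‖v‖ ^ 2 ≤ (inner ℂ e v).re) ∧
      (B v v + η * ‖v‖ ^ 2 < (inner ℂ e v).re → p + v ∈ Ω))
    (r : ℝ) (hr : 0 ≤ r) (hr1 : r < 1) :
    ∃ f : E → E, DifferentiableOn ℂ f Ω ∧ InjOn f Ω ∧ f '' Ω ⊆ ball 0 1 ∧
      closedBall 0 r ⊆ f '' Ω := by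
  set F : Submodule ℂ E := (ℂ ∙ e)ᗮ with hF
  set j : F →ₗᵢ[ℂ] E := F.subtypeₗᵢ with hjdef
  set P : E →L[ℂ] F := F.orthogonalProjectionOnto with hP
  have hj : ∀ z : F, inner ℂ e (j z) = 0 := fun z =>
    Submodule.mem_orthogonal_singleton_iff_inner_right.1 z.2
  have hee : inner ℂ e e = 1 := by
    rw [inner_self_eq_norm_sq_to_K, he]; simp
  have hinner : ∀ (w : ℂ) (z : F), inner ℂ e (w • e + j z) = w := fun w z => by
    rw [inner_add_right, inner_smul_right, hee, hj, mul_one, add_zero]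
  have hnorm : ∀ (w : ℂ) (z : F), ‖w • e + j z‖ ^ 2 = ‖w‖ ^ 2 + ‖z‖ ^ 2 := fun w z => by
    have h0 : inner ℂ (w • e) (j z) = 0 := by rw [inner_smul_left, hj, mul_zero]
    have := norm_add_sq_eq_norm_sq_add_norm_sq_of_inner_eq_zero _ _ h0
    rw [norm_smul, he, mul_one, j.norm_map] at this
    linarith
  have hPadd : ∀ (w : ℂ) (z : F), P (w • e + j z) = z := fun w z => by
    have h1 : P e = 0 := by
      rw [hP, Submodule.orthogonalProjectionOnto_eq_zero_iff, hF, Submodule.orthogonal_orthogonal]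
      exact Submodule.mem_span_singleton_self e
    have h2 : P (j z) = z := Submodule.orthogonalProjectionOnto_mem_subspace_eq_self z
    rw [map_add, map_smul, h1, h2, smul_zero, zero_add]
  have hsplit : ∀ x, inner ℂ e x • e + j (P x) = x := fun x => by
    have hmem : x - inner ℂ e x • e ∈ F := by
      rw [hF, Submodule.mem_orthogonal_singleton_iff_inner_right, inner_sub_right,
        inner_smul_right, hee, mul_one, sub_self]
    have hx : x = inner ℂ e x • e + j ⟨_, hmem⟩ := (add_sub_cancel _ _).symm
    have := hPadd (inner ℂ e x) ⟨_, hmem⟩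
    rw [← hx] at this
    rw [this, ← hx]
  obtain ⟨A, Λ, κ, hκ, hκ1, hq, hU, hT⟩ :=
    exists_normal_coordinates Ω p e he j hj κ₀ hκ₀ hΩ B hBs hB
  set U : Set (ℂ × F) := {q | p + (q.1 • e + j (A.symm q.2)) ∈ Ω} with hUdef
  obtain ⟨ε, hε, hε1, hεr⟩ : ∃ ε : ℝ, 0 < ε ∧ ε < 1 ∧ (1 + ε) * r ^ 2 < 1 - ε := by
    have : r ^ 2 < 1 := by nlinarith
    exact ⟨(1 - r ^ 2) / 4, by linarith, by nlinarith, by nlinarith⟩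
  obtain ⟨g, C, hC, hg, hginj, hgout, hgin⟩ := exists_shear Λ U κ hκ hκ1 hq hU hT ε hε
  obtain ⟨α, β, γ, s, hs, hmap, hminj, hmsurj⟩ :=
    exists_projective_map (F := F) C ε r hC hε hε1 hr hr1 hεr
  set W : E → ℂ := fun x => inner ℂ e (x - p) with hW
  set Z : E → F := fun x => A (P (x - p)) with hZ
  set S : E → ℂ := fun x => W x - Λ (Z x) (Z x) * g (W x) with hS
  have hmemU : ∀ x ∈ Ω, (W x, Z x) ∈ U := fun x hx => by
    change p + (W x • e + j (A.symm (Z x))) ∈ Ω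
    rwa [hZ, A.symm_apply_apply, hW, hsplit, add_sub_cancel]
  have hrec : ∀ x, p + (W x • e + j (A.symm (Z x))) = x := fun x => by
    rw [hZ, A.symm_apply_apply, hW, hsplit, add_sub_cancel]
  have hin : ∀ x ∈ Ω, α + γ * S x ≠ 0 ∧
      ‖(α + β * S x) / (α + γ * S x)‖ ^ 2 + ‖(s / (α + γ * S x)) • Z x‖ ^ 2 < 1 := fun x hx =>
    hmap _ _ (hgout _ _ (hmemU x hx))
  have hWd : Differentiable ℂ W :=
    (innerSL ℂ e).differentiable.comp (differentiable_id.sub_const p)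
  have hZd : Differentiable ℂ Z :=
    A.differentiable.comp (P.differentiable.comp (differentiable_id.sub_const p))
  have hSd : DifferentiableOn ℂ S Ω := by
    refine hWd.differentiableOn.sub (DifferentiableOn.mul ?_ ?_)
    · exact ((Λ.differentiable.comp hZd).clm_apply hZd).differentiableOn
    · refine hg.comp hWd.differentiableOn fun x hx => ?_
      have := hU _ _ (hmemU x hx)
      exact lt_of_le_of_lt (by positivity) this
  refine ⟨fun x => ((α + β * S x) / (α + γ * S x)) • e + j ((s / (α + γ * S x)) • Z x),
    ?_, ?_, ?_, ?_⟩
  · have hden : DifferentiableOn ℂ (fun x => α + γ * S x) Ω := (hSd.const_mul γ).const_add α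
    have h0 : ∀ x ∈ Ω, α + γ * S x ≠ 0 := fun x hx => (hin x hx).1
    have hinv : DifferentiableOn ℂ (fun x => (α + γ * S x)⁻¹) Ω := hden.fun_inv h0
    simp only [div_eq_mul_inv]
    refine ((((hSd.const_mul β).const_add α).mul hinv).smul_const e).add ?_
    exact j.toContinuousLinearMap.differentiable.comp_differentiableOn
      ((hinv.const_mul s).smul hZd.differentiableOn)
  · intro x hx y hy hxy
    have hw := congrArg (fun v => inner ℂ e v) hxy
    have hz := congrArg P hxy
    simp only [hinner, hPadd] at hw hz
    have hSS : S x = S y := hminj _ _ (hin x hx).1 (hin y hy).1 hw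
    rw [hSS] at hz
    have hZZ : Z x = Z y := smul_right_injective F (div_ne_zero hs (hin y hy).1) hz
    have hWW : W x = W y := by
      refine hginj _ _ (Z x) (hmemU x hx) ?_ ?_
      · rw [hZZ]; exact hmemU y hy
      · have h := hSS
        simp only [hS] at h
        rw [← hZZ] at h
        exact h
    rw [← hrec x, ← hrec y, hWW, hZZ]
  · rintro _ ⟨x, hx, rfl⟩
    rw [mem_ball_zero_iff, ← sq_lt_one_iff₀ (norm_nonneg _), hnorm]
    exact (hin x hx).2
  · intro v hv
    rw [mem_closedBall_zero_iff] at hv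
    obtain ⟨w', z, hlt, hu, hy⟩ := hmsurj (inner ℂ e v) (P v) (by
      rw [← hnorm, hsplit]; gcongr)
    obtain ⟨w, hwU, hw⟩ := hgin w' z hlt
    refine ⟨p + (w • e + j (A.symm z)), hwU, ?_⟩
    have h1 : W (p + (w • e + j (A.symm z))) = w := by
      simp only [hW, add_sub_cancel_left, hinner]
    have h2 : Z (p + (w • e + j (A.symm z))) = z := by
      simp only [hZ, add_sub_cancel_left, hPadd, A.apply_symm_apply]
    have h3 : S (p + (w • e + j (A.symm z))) = w' := by
      simp only [hS, h1, h2, hw]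
    simp only [h2, h3, hu, hy, hsplit]

/-- (Exhaustion theorem.) If a bounded domain `Ω ⊆ ℂⁿ` admits a
spherically-extreme boundary point `p`, then the unit ball is exhausted by
biholomorphic images of `Ω`: there are injective holomorphic maps `f_j : Ω → 𝔹ⁿ`
such that every compact `K ⊆ 𝔹ⁿ` satisfies `K ⊆ f_j(Ω)` for all large `j`. -/
theorem ball_exhaustion_of_spherically_extreme (n : ℕ)
    (Ω : Set (EuclideanSpace ℂ (Fin n)))
    (hopen : IsOpen Ω) (hconn : IsConnected Ω) (hbdd : Bornology.IsBounded Ω)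
    (p : EuclideanSpace ℂ (Fin n)) (hp : p ∈ frontier Ω)
    (r₀ : ℝ) (hr₀ : 0 < r₀)
    (ρ : EuclideanSpace ℂ (Fin n) → ℝ)
    (hρ : ContDiffOn ℝ 2 ρ (ball p r₀))
    (hgrad : ∀ x ∈ ball p r₀, fderiv ℝ ρ x ≠ 0)
    (hdef : Ω ∩ ball p r₀ = {x | ρ x < 0} ∩ ball p r₀)
    (c : EuclideanSpace ℂ (Fin n)) (R : ℝ) (hR : 0 < R)
    (hΩball : Ω ⊆ ball c R) (hpc : ‖p - c‖ = R) :
    ∃ f : ℕ → EuclideanSpace ℂ (Fin n) → EuclideanSpace ℂ (Fin n),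
      (∀ j, DifferentiableOn ℂ (f j) Ω ∧ InjOn (f j) Ω ∧ f j '' Ω ⊆ ball 0 1) ∧
      ∀ K : Set (EuclideanSpace ℂ (Fin n)), IsCompact K → K ⊆ ball 0 1 →
        ∃ j₀ : ℕ, ∀ j ≥ j₀, K ⊆ f j '' Ω := by
  have hcp : ‖c - p‖ = R := by rw [norm_sub_rev, hpc]
  set e : EuclideanSpace ℂ (Fin n) := ((R⁻¹ : ℝ) : ℂ) • (c - p) with he
  have hen : ‖e‖ = 1 := by
    rw [he, norm_smul, hcp, Complex.norm_real, Real.norm_of_nonneg (by positivity)]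
    field_simp
  have hΩ : ∀ v, p + v ∈ Ω → 1 / (2 * R) * ‖v‖ ^ 2 < (inner ℂ e v).re := fun v hv => by
    have h1 := hΩball hv
    rw [mem_ball, dist_eq_norm, show p + v - c = v - (c - p) by abel] at h1
    have h2 : ‖v - (c - p)‖ ^ 2 < R ^ 2 := by gcongr
    rw [norm_sub_sq (𝕜 := ℂ), hcp] at h2
    have h3 : (inner ℂ e v).re = R⁻¹ * (inner ℂ (c - p) v).re := by
      rw [he, inner_smul_left, Complex.conj_ofReal, Complex.re_ofReal_mul]
    have h4 : RCLike.re (inner ℂ v (c - p)) = (inner ℂ (c - p) v).re := inner_re_symm v (c - p)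
    rw [h4] at h2
    rw [h3]
    calc 1 / (2 * R) * ‖v‖ ^ 2 < 1 / (2 * R) * (2 * (inner ℂ (c - p) v).re) := by
          gcongr; linarith
      _ = _ := by field_simp
  obtain ⟨B, hBs, hB⟩ := exists_quadratic_graph Ω hopen p hp r₀ hr₀ ρ hρ
    (hgrad p (mem_ball_self hr₀)) hdef e hen
    fun v hv => (lt_of_le_of_lt (by positivity) (hΩ v hv)).le
  have hf : ∀ j : ℕ, ∃ f : EuclideanSpace ℂ (Fin n) → EuclideanSpace ℂ (Fin n),
      DifferentiableOn ℂ f Ω ∧ InjOn f Ω ∧ f '' Ω ⊆ ball 0 1 ∧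
        closedBall 0 (1 - 1 / ((j : ℝ) + 1)) ⊆ f '' Ω := fun j =>
    exists_embedding_covering_closedBall Ω p e hen (1 / (2 * R)) (by positivity) hΩ B hBs hB _
      (sub_nonneg.2 (by
        rw [div_le_one (by positivity)]
        linarith [Nat.cast_nonneg (α := ℝ) j]))
      (sub_lt_self _ (by positivity))
  choose f hfd hfi hfb hfc using hf
  refine ⟨f, fun j => ⟨hfd j, hfi j, hfb j⟩, fun K hK hK1 => ?_⟩
  obtain ⟨r, hr1, hr⟩ : ∃ r < 1, K ⊆ closedBall 0 r := by
    rcases K.eq_empty_or_nonempty with rfl | hne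
    · exact ⟨0, one_pos, empty_subset _⟩
    · obtain ⟨x, hx, hmax⟩ := hK.exists_isMaxOn hne continuous_norm.continuousOn
      exact ⟨‖x‖, mem_ball_zero_iff.1 (hK1 hx), fun y hy => mem_closedBall_zero_iff.2 (hmax hy)⟩
  obtain ⟨j₀, hj₀⟩ := exists_nat_one_div_lt (sub_pos.2 hr1)
  refine ⟨j₀, fun j hj => (hr.trans (closedBall_subset_closedBall ?_)).trans (hfc j)⟩
  have := one_div_le_one_div_of_le (by positivity : (0 : ℝ) < j₀ + 1)
    (by gcongr : (j₀ : ℝ) + 1 ≤ j + 1)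
  linarith
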